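/- arXiv:1903.11681 — 2 statements merged into one kernel-verified Lean document; each statement's English description precedes it below -/
import Mathlib

section
/- For every i-sequence (i_0, i_1, …, i_L), the linear automorphism σ_{i_L}σ_{i_{L−1}}⋯σ_{i_1}σ_{i_0} of Z^{I_0} cannot be written as a product of fewer than L+1 elements of {σ_i : i ∈ I_0}; that is, the word s_{i_L}⋯s_{i_1}s_{i_0} is a reduced expression in the Weyl group of g_0. The same holds for every j-sequence (j_0, …, j_{L'}): σ_{j_{L'}}⋯σ_{j_0} cannot be written as a product of fewer than L'+1 of the σ_i. -/
/-- The five affine types considered in the paper. -/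
inductive AffCase : Type
  | E6 | E7 | E8 | F4 | E62
  deriving DecidableEq

open AffCase

/-- The rank `n` of the underlying finite-type algebra `g_0`. -/
def rank : AffCase → ℕ
  | E6 => 6 | E7 => 7 | E8 => 8 | F4 => 4 | E62 => 4

/-- Edges of the Dynkin diagram of `g_0`. -/
def adj : AffCase → List (ℕ × ℕ)
  | E6  => [(1,2),(2,3),(2,4),(3,5),(4,6)]
  | E7  => [(1,2),(2,3),(3,4),(3,5),(5,6),(6,7)]
  | E8  => [(1,2),(2,3),(3,4),(4,5),(5,6),(5,7),(7,8)]
  | F4  => [(1,2),(2,3),(3,4)]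
  | E62 => [(1,2),(2,3),(3,4)]

/-- The Cartan matrix `c_{ij}` of `g_0`. -/
def cartan (c : AffCase) (i j : ℕ) : ℤ :=
  if i = j then 2
  else if (i, j) ∈ adj c ∨ (j, i) ∈ adj c then
    if (c = F4 ∧ i = 3 ∧ j = 2) ∨ (c = E62 ∧ i = 2 ∧ j = 3) then -2 else -1
  else 0

/-- The index set `I_0 = {1,…,n}`. -/
def I0 (c : AffCase) : Finset ℕ := Finset.Icc 1 (rank c)

/-- The index set `I_{01} = I_0 \ {1} = {2,…,n}`. -/
def I01 (c : AffCase) : Finset ℕ := Finset.Icc 2 (rank c)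

/-- The constant `c` : `2` in case `F4^(1)`, `1` otherwise. -/
def cconst : AffCase → ℤ
  | F4 => 2
  | _ => 1

/-- The pairing `⟨h_i, v⟩ = Σ_j c_{ij} v_j`. -/
def pairing (c : AffCase) (i : ℕ) (v : ℕ → ℤ) : ℤ :=
  ∑ j ∈ I0 c, cartan c i j * v j

/-- The standard basis vector `e_i` of the root lattice. -/
def stdb (i : ℕ) : ℕ → ℤ := fun j => if j = i then 1 else 0

/-- The simple reflection `σ_i(v) = v − ⟨h_i, v⟩ e_i`. -/
def sref (c : AffCase) (i : ℕ) (v : ℕ → ℤ) : ℕ → ℤ :=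
  fun j => v j - if j = i then pairing c i v else 0

/-- `srefs c f k v = σ_{f k} ⋯ σ_{f 1} (v)` (note: `f 0` is not applied). -/
def srefs (c : AffCase) (f : ℕ → ℕ) : ℕ → (ℕ → ℤ) → (ℕ → ℤ)
  | 0, v => v
  | k+1, v => sref c (f (k+1)) (srefs c f k v)

/-- The root `θ_1`. -/
def theta1 (c : AffCase) : ℕ → ℤ := fun j =>
  (match c with
    | E6  => ([0,0,1,1,1,1,1] : List ℤ)
    | E7  => ([0,0,1,2,1,2,2,1] : List ℤ)
    | E8  => ([0,0,1,2,3,4,2,3,2] : List ℤ)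
    | F4  => ([0,0,1,2,2] : List ℤ)
    | E62 => ([0,0,1,1,1] : List ℤ)).getD j 0

/-- The subset `J ⊆ I_0`. -/
def Jset : AffCase → Finset ℕ
  | E6  => {2,3,4}
  | E7  => {2,3,4,5}
  | E8  => {2,3,4,5,6,7}
  | F4  => {2,3}
  | E62 => {2,3}

/-- The root `θ_J`. -/
def thetaJ (c : AffCase) : ℕ → ℤ := fun j =>
  (match c with
    | E6  => ([0,0,1,1,1,0,0] : List ℤ)
    | E7  => ([0,0,1,2,1,1,0,0] : List ℤ)
    | E8  => ([0,0,1,2,2,2,1,1,0] : List ℤ)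
    | F4  => ([0,0,1,2,0] : List ℤ)
    | E62 => ([0,0,1,1,0] : List ℤ)).getD j 0

/-- `(L, f)` encodes an i-sequence `(i_0, …, i_L) = (f 0, …, f L)`. -/
def IsISeq (c : AffCase) (L : ℕ) (f : ℕ → ℕ) : Prop :=
  (∀ k ≤ L, f k ∈ I01 c) ∧ f 0 = 2 ∧
  (∀ k, 1 ≤ k → k ≤ L →
    pairing c (f k) (srefs c f (k-1) (stdb 2)) = -(cconst c)) ∧
  srefs c f L (stdb 2) = theta1 c

/-- `(L, f)` encodes a j-sequence `(j_0, …, j_L) = (f 0, …, f L)`. -/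
def IsJSeq (c : AffCase) (L : ℕ) (f : ℕ → ℕ) : Prop :=
  (∀ k ≤ L, f k ∈ Jset c) ∧ f 0 = 2 ∧
  (∀ k, 1 ≤ k → k ≤ L →
    pairing c (f k) (srefs c f (k-1) (stdb 2)) = -(cconst c)) ∧
  srefs c f L (stdb 2) = thetaJ c

/-- `wordApply c [a, b, …, z] v = σ_a (σ_b ( ⋯ (σ_z v)))` : the head of the
list is applied last. -/
def wordApply (c : AffCase) (w : List ℕ) (v : ℕ → ℤ) : ℕ → ℤ :=
  w.foldr (fun i u => sref c i u) v

/-- The symmetrizer of the Cartan matrix: `symmetrizer c i * cartan c i j` is symmetric. -/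
def symmetrizer (c : AffCase) (i : ℕ) : ℤ :=
  if (c = F4 ∧ i ≤ 2) ∨ (c = E62 ∧ 3 ≤ i) then 2 else 1

/-- The weights for which simple reflections move the roots in the orbit of `e_2` by at most
`cconst c` in height, apart from the sign changes of simple roots. -/
def weight (c : AffCase) (i : ℕ) : ℤ := if c = F4 ∧ i ≤ 2 then 2 else 1

/-- The height of a lattice vector with respect to `weight`. -/
def height (c : AffCase) (v : ℕ → ℤ) : ℤ := ∑ i ∈ I0 c, weight c i * v i

/-- The Weyl group invariant quadratic form on the root lattice. -/
def normForm (c : AffCase) (v : ℕ → ℤ) : ℤ :=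
  ∑ i ∈ I0 c, symmetrizer c i * v i * pairing c i v

/-- The height, with the gap between `-cconst c` and `cconst c` shrunk to `cconst c`. -/
def gapHeight (c : AffCase) (v : ℕ → ℤ) : ℤ :=
  max (height c v) (cconst c) + min (height c v) 0

theorem symmetrizer_mul_cartan (c : AffCase) :
    ∀ i ∈ I0 c, ∀ j ∈ I0 c,
      symmetrizer c i * cartan c i j = symmetrizer c j * cartan c j i := by
  cases c <;> decide

theorem two_mem_I0 (c : AffCase) : 2 ∈ I0 c := by cases c <;> decide

theorem cartan_self (c : AffCase) (i : ℕ) : cartan c i i = 2 := by simp [cartan]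

theorem sref_eq_add_smul (c : AffCase) (i : ℕ) (v : ℕ → ℤ) :
    sref c i v = v + (-pairing c i v) • stdb i := by
  ext j
  by_cases h : j = i <;> simp [sref, stdb, h, sub_eq_add_neg]

theorem sum_mul_stdb {c : AffCase} {i : ℕ} (hi : i ∈ I0 c) (a : ℕ → ℤ) :
    ∑ j ∈ I0 c, a j * stdb i j = a i := by
  simp [stdb, hi]

theorem pairing_add_smul {c : AffCase} {i : ℕ} (hi : i ∈ I0 c) (k : ℕ) (v : ℕ → ℤ) (t : ℤ) :
    pairing c k (v + t • stdb i) = pairing c k v + t * cartan c k i := by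
  have h := sum_mul_stdb hi (cartan c k)
  simp only [pairing, Pi.add_apply, Pi.smul_apply, smul_eq_mul, mul_add, Finset.sum_add_distrib,
    mul_left_comm _ t, ← Finset.mul_sum, h]

theorem height_add_smul {c : AffCase} {i : ℕ} (hi : i ∈ I0 c) (v : ℕ → ℤ) (t : ℤ) :
    height c (v + t • stdb i) = height c v + t * weight c i := by
  have h := sum_mul_stdb hi (weight c)
  simp only [height, Pi.add_apply, Pi.smul_apply, smul_eq_mul, mul_add, Finset.sum_add_distrib,
    mul_left_comm _ t, ← Finset.mul_sum, h]

theorem sum_symmetrizer_mul_cartan {c : AffCase} {i : ℕ} (hi : i ∈ I0 c) (v : ℕ → ℤ) :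
    ∑ k ∈ I0 c, symmetrizer c k * v k * cartan c k i = symmetrizer c i * pairing c i v := by
  rw [pairing, Finset.mul_sum]
  refine Finset.sum_congr rfl fun k hk => ?_
  linear_combination v k * symmetrizer_mul_cartan c k hk i hi

theorem normForm_add_smul {c : AffCase} {i : ℕ} (hi : i ∈ I0 c) (v : ℕ → ℤ) (t : ℤ) :
    normForm c (v + t • stdb i) =
      normForm c v + 2 * t * (symmetrizer c i * pairing c i v) + 2 * t ^ 2 * symmetrizer c i := by
  have h₁ := sum_mul_stdb hi fun k => symmetrizer c k * pairing c k v
  have h₂ := sum_mul_stdb hi fun k => symmetrizer c k * cartan c k i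
  have h₃ := sum_symmetrizer_mul_cartan hi v
  have h : normForm c (v + t • stdb i) = normForm c v
      + t * ∑ k ∈ I0 c, symmetrizer c k * pairing c k v * stdb i k
      + t * ∑ k ∈ I0 c, symmetrizer c k * v k * cartan c k i
      + t ^ 2 * ∑ k ∈ I0 c, symmetrizer c k * cartan c k i * stdb i k := by
    simp only [normForm, pairing_add_smul hi, Finset.mul_sum, ← Finset.sum_add_distrib]
    refine Finset.sum_congr rfl fun k _ => ?_
    simp only [Pi.add_apply, Pi.smul_apply, smul_eq_mul]
    ring
  rw [h, h₁, h₂, h₃, cartan_self]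
  ring

theorem normForm_sref {c : AffCase} {i : ℕ} (hi : i ∈ I0 c) (v : ℕ → ℤ) :
    normForm c (sref c i v) = normForm c v := by
  rw [sref_eq_add_smul, normForm_add_smul hi]
  ring

theorem normForm_stdb {c : AffCase} {i : ℕ} (hi : i ∈ I0 c) :
    normForm c (stdb i) = 2 * symmetrizer c i := by
  have h := normForm_add_smul hi 0 1
  simpa [normForm, pairing] using h

theorem height_stdb_two (c : AffCase) : height c (stdb 2) = cconst c := by
  rw [height, sum_mul_stdb (two_mem_I0 c)]
  cases c <;> rfl

/-- The invariant form is positive definite. -/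
theorem eq_zero_of_normForm_nonpos {c : AffCase} {v : ℕ → ℤ} (h : normForm c v ≤ 0) :
    ∀ j ∈ I0 c, v j = 0 := by
  have key : ∀ x : ℤ, x ^ 2 ≤ 0 → x = 0 := fun x hx =>
    pow_eq_zero_iff two_ne_zero |>.1 (le_antisymm hx (sq_nonneg x))
  cases c <;>
    simp [normForm, pairing, I0, rank, cartan, adj, symmetrizer,
      Finset.sum_Icc_succ_top] at h
  case E6 =>
    have n0 := sq_nonneg (v 2)
    have n1 := sq_nonneg (2 * v 1 - v 2)
    have n2 := sq_nonneg (2 * v 5 - v 3)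
    have n3 := sq_nonneg (2 * v 6 - v 4)
    have n4 := sq_nonneg (3 * v 3 - 2 * v 2)
    have n5 := sq_nonneg (3 * v 4 - 2 * v 2)
    have z0 := key (v 2) (by linarith)
    have z1 := key (2 * v 1 - v 2) (by linarith)
    have z2 := key (2 * v 5 - v 3) (by linarith)
    have z3 := key (2 * v 6 - v 4) (by linarith)
    have z4 := key (3 * v 3 - 2 * v 2) (by linarith)
    have z5 := key (3 * v 4 - 2 * v 2) (by linarith)
    intro j hj
    obtain ⟨hj₁, hj₂⟩ := Finset.mem_Icc.1 hj
    simp only [rank] at hj₂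
    interval_cases j <;> omega
  case E7 =>
    have n0 := sq_nonneg (v 3)
    have n1 := sq_nonneg (2 * v 1 - v 2)
    have n2 := sq_nonneg (3 * v 2 - 2 * v 3)
    have n3 := sq_nonneg (2 * v 4 - v 3)
    have n4 := sq_nonneg (2 * v 7 - v 6)
    have n5 := sq_nonneg (3 * v 6 - 2 * v 5)
    have n6 := sq_nonneg (4 * v 5 - 3 * v 3)
    have z0 := key (v 3) (by linarith)
    have z1 := key (2 * v 1 - v 2) (by linarith)
    have z2 := key (3 * v 2 - 2 * v 3) (by linarith)
    have z3 := key (2 * v 4 - v 3) (by linarith)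
    have z4 := key (2 * v 7 - v 6) (by linarith)
    have z5 := key (3 * v 6 - 2 * v 5) (by linarith)
    have z6 := key (4 * v 5 - 3 * v 3) (by linarith)
    intro j hj
    obtain ⟨hj₁, hj₂⟩ := Finset.mem_Icc.1 hj
    simp only [rank] at hj₂
    interval_cases j <;> omega
  case E8 =>
    have n0 := sq_nonneg (v 5)
    have n1 := sq_nonneg (2 * v 1 - v 2)
    have n2 := sq_nonneg (3 * v 2 - 2 * v 3)
    have n3 := sq_nonneg (4 * v 3 - 3 * v 4)
    have n4 := sq_nonneg (5 * v 4 - 4 * v 5)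
    have n5 := sq_nonneg (2 * v 6 - v 5)
    have n6 := sq_nonneg (2 * v 8 - v 7)
    have n7 := sq_nonneg (3 * v 7 - 2 * v 5)
    have z0 := key (v 5) (by linarith)
    have z1 := key (2 * v 1 - v 2) (by linarith)
    have z2 := key (3 * v 2 - 2 * v 3) (by linarith)
    have z3 := key (4 * v 3 - 3 * v 4) (by linarith)
    have z4 := key (5 * v 4 - 4 * v 5) (by linarith)
    have z5 := key (2 * v 6 - v 5) (by linarith)
    have z6 := key (2 * v 8 - v 7) (by linarith)
    have z7 := key (3 * v 7 - 2 * v 5) (by linarith)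
    intro j hj
    obtain ⟨hj₁, hj₂⟩ := Finset.mem_Icc.1 hj
    simp only [rank] at hj₂
    interval_cases j <;> omega
  case F4 =>
    have n0 := sq_nonneg (v 3)
    have n1 := sq_nonneg (2 * v 1 - v 2)
    have n2 := sq_nonneg (3 * v 2 - 2 * v 3)
    have n3 := sq_nonneg (2 * v 4 - v 3)
    have z0 := key (v 3) (by linarith)
    have z1 := key (2 * v 1 - v 2) (by linarith)
    have z2 := key (3 * v 2 - 2 * v 3) (by linarith)
    have z3 := key (2 * v 4 - v 3) (by linarith)
    intro j hj
    obtain ⟨hj₁, hj₂⟩ := Finset.mem_Icc.1 hj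
    simp only [rank] at hj₂
    interval_cases j <;> omega
  case E62 =>
    have n0 := sq_nonneg (v 3)
    have n1 := sq_nonneg (2 * v 1 - v 2)
    have n2 := sq_nonneg (3 * v 2 - 4 * v 3)
    have n3 := sq_nonneg (2 * v 4 - v 3)
    have z0 := key (v 3) (by linarith)
    have z1 := key (2 * v 1 - v 2) (by linarith)
    have z2 := key (3 * v 2 - 4 * v 3) (by linarith)
    have z3 := key (2 * v 4 - v 3) (by linarith)
    intro j hj
    obtain ⟨hj₁, hj₂⟩ := Finset.mem_Icc.1 hj
    simp only [rank] at hj₂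
    interval_cases j <;> omega

theorem add_symmetrizer_le {c : AffCase} {i : ℕ} {p : ℤ}
    (h : cconst c < weight c i * p) :
    symmetrizer c 2 + symmetrizer c i ≤ symmetrizer c i * p := by
  cases c <;> grind [cconst, weight, symmetrizer]

theorem weight_eq_cconst {c : AffCase} {i : ℕ} (h : cconst c < weight c i * 2) :
    weight c i = cconst c := by
  cases c <;> grind [cconst, weight]

theorem height_eq_of_cconst_lt {c : AffCase} {i : ℕ} (hi : i ∈ I0 c) {v : ℕ → ℤ}
    (hv : normForm c v = 2 * symmetrizer c 2) {e : ℤ} (he : e ^ 2 = 1)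
    (h : cconst c < weight c i * (e * pairing c i v)) :
    height c v = e * cconst c ∧ weight c i * (e * pairing c i v) = 2 * cconst c := by
  have hzero : ∀ j ∈ I0 c, (v + (-e) • stdb i) j = 0 := by
    apply eq_zero_of_normForm_nonpos
    rw [normForm_add_smul hi, hv]
    have := add_symmetrizer_le h
    linear_combination 2 * this + 2 * symmetrizer c i * he
  have hheight : height c (v + (-e) • stdb i) = 0 :=
    Finset.sum_eq_zero fun j hj => by rw [hzero j hj, mul_zero]
  have hpairing : pairing c i (v + (-e) • stdb i) = 0 :=
    Finset.sum_eq_zero fun j hj => by rw [hzero j hj, mul_zero]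
  rw [height_add_smul hi] at hheight
  rw [pairing_add_smul hi, cartan_self] at hpairing
  have hp : e * pairing c i v = 2 := by linear_combination e * hpairing + 2 * he
  rw [hp] at h ⊢
  have hw := weight_eq_cconst h
  rw [hw] at hheight ⊢
  exact ⟨by linear_combination hheight, mul_comm _ _⟩

theorem gapHeight_sref {c : AffCase} {i : ℕ} (hi : i ∈ I0 c) {v : ℕ → ℤ}
    (hv : normForm c v = 2 * symmetrizer c 2) :
    gapHeight c v - cconst c ≤ gapHeight c (sref c i v) := by
  have hpos := height_eq_of_cconst_lt hi hv (e := 1) (by norm_num)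
  have hneg := height_eq_of_cconst_lt hi hv (e := -1) (by norm_num)
  have hc : 0 < cconst c := by cases c <;> decide
  rw [gapHeight, gapHeight, sref_eq_add_smul, height_add_smul hi]
  have hcomm : -pairing c i v * weight c i = -(weight c i * pairing c i v) := by ring
  simp only [one_mul, neg_mul, mul_neg] at hpos hneg
  rw [hcomm]
  omega

theorem normForm_wordApply {c : AffCase} (v : ℕ → ℤ) {w : List ℕ} (hw : ∀ i ∈ w, i ∈ I0 c) :
    normForm c (wordApply c w v) = normForm c v := by
  induction w with
  | nil => rfl
  | cons i w ih =>
    rw [List.forall_mem_cons] at hw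
    exact (normForm_sref hw.1 _).trans (ih hw.2)

theorem gapHeight_wordApply {c : AffCase} {v : ℕ → ℤ} (hv : normForm c v = 2 * symmetrizer c 2)
    {w : List ℕ} (hw : ∀ i ∈ w, i ∈ I0 c) :
    gapHeight c v - cconst c * w.length ≤ gapHeight c (wordApply c w v) := by
  induction w with
  | nil => simp [wordApply]
  | cons i w ih =>
    rw [List.forall_mem_cons] at hw
    have hstep := gapHeight_sref hw.1 ((normForm_wordApply v hw.2).trans hv)
    have hrec := ih hw.2
    change _ ≤ gapHeight c (sref c i (wordApply c w v))
    push_cast [List.length_cons]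
    linarith

theorem sref_neg (c : AffCase) (i : ℕ) (v : ℕ → ℤ) : sref c i (-v) = -sref c i v := by
  have h : pairing c i (-v) = -pairing c i v := by simp [pairing]
  rw [sref_eq_add_smul, sref_eq_add_smul, h]
  module

theorem srefs_neg (c : AffCase) (f : ℕ → ℕ) (k : ℕ) (v : ℕ → ℤ) :
    srefs c f k (-v) = -srefs c f k v := by
  induction k with
  | zero => rfl
  | succ k ih => rw [srefs, ih, sref_neg, srefs]

theorem sref_stdb_self {c : AffCase} {i : ℕ} (hi : i ∈ I0 c) :
    sref c i (stdb i) = -stdb i := by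
  have h : pairing c i (stdb i) = 2 := by rw [pairing, sum_mul_stdb hi, cartan_self]
  rw [sref_eq_add_smul, h]
  module

theorem le_height_srefs {c : AffCase} {f : ℕ → ℕ} {L : ℕ} (hf : ∀ k ≤ L, f k ∈ I0 c)
    (hp : ∀ k, 1 ≤ k → k ≤ L → pairing c (f k) (srefs c f (k - 1) (stdb 2)) = -cconst c) :
    cconst c * (L + 1) ≤ height c (srefs c f L (stdb 2)) := by
  induction L with
  | zero => simp [srefs, height_stdb_two]
  | succ L ih =>
    have hrec := ih (fun k hk => hf k (by omega)) fun k h₁ hk => hp k h₁ (by omega)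
    have hpL := hp (L + 1) (by omega) le_rfl
    rw [Nat.add_sub_cancel] at hpL
    have hc : 0 < cconst c := by cases c <;> decide
    have hw : 1 ≤ weight c (f (L + 1)) := by unfold weight; split_ifs <;> norm_num
    rw [srefs, sref_eq_add_smul, height_add_smul (hf _ le_rfl), hpL]
    push_cast
    nlinarith

/-- If each step of the sequence raises the height of the root, the word it spells is reduced. -/
theorem lt_length_of_wordApply_eq_srefs {c : AffCase} {f : ℕ → ℕ} {L : ℕ}
    (hf : ∀ k ≤ L, f k ∈ I0 c) (hzero : f 0 = 2)
    (hp : ∀ k, 1 ≤ k → k ≤ L → pairing c (f k) (srefs c f (k - 1) (stdb 2)) = -cconst c)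
    {w : List ℕ} (hw : ∀ i ∈ w, i ∈ I0 c)
    (h : wordApply c w (stdb 2) = srefs c f L (sref c (f 0) (stdb 2))) :
    L + 1 ≤ w.length := by
  have hgap := gapHeight_wordApply (normForm_stdb (two_mem_I0 c)) hw
  have hL := le_height_srefs hf hp
  have hneg (v : ℕ → ℤ) : height c (-v) = -height c v := by simp [height]
  have hc : 0 < cconst c := by cases c <;> decide
  have hcL : 0 ≤ cconst c * L := by positivity
  rw [h, hzero, sref_stdb_self (two_mem_I0 c), srefs_neg, gapHeight, gapHeight, hneg,
    height_stdb_two, max_self, min_eq_right hc.le, max_eq_right (by linarith),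
    min_eq_left (by linarith)] at hgap
  have hmul : cconst c * ((L : ℤ) + 1) ≤ cconst c * w.length := by linarith
  exact_mod_cast le_of_mul_le_mul_left hmul hc

theorem I01_subset_I0 (c : AffCase) : I01 c ⊆ I0 c := by cases c <;> decide

theorem Jset_subset_I0 (c : AffCase) : Jset c ⊆ I0 c := by cases c <;> decide

theorem stmt4 (c : AffCase) :
    (∀ (L : ℕ) (f : ℕ → ℕ), IsISeq c L f →
      ¬ ∃ w : List ℕ, (∀ i ∈ w, i ∈ I0 c) ∧ w.length < L + 1 ∧
        ∀ v : ℕ → ℤ, wordApply c w v = srefs c f L (sref c (f 0) v)) ∧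
    (∀ (L' : ℕ) (g : ℕ → ℕ), IsJSeq c L' g →
      ¬ ∃ w : List ℕ, (∀ i ∈ w, i ∈ I0 c) ∧ w.length < L' + 1 ∧
        ∀ v : ℕ → ℤ, wordApply c w v = srefs c g L' (sref c (g 0) v)) := by
  constructor
  · rintro L f ⟨hf, hzero, hp, -⟩ ⟨w, hw, hlen, h⟩
    exact hlen.not_ge <| lt_length_of_wordApply_eq_srefs
      (fun k hk => I01_subset_I0 c (hf k hk)) hzero hp hw (h _)
  · rintro L g ⟨hg, hzero, hp, -⟩ ⟨w, hw, hlen, h⟩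
    exact hlen.not_ge <| lt_length_of_wordApply_eq_srefs
      (fun k hk => Jset_subset_I0 c (hg k hk)) hzero hp hw (h _)
end

section
/- For every i-sequence (i_0, …, i_L) and every j-sequence (j_0, …, j_{L'}), the linear automorphism σ_{j_{L'}}⋯σ_{j_1}σ_{j_0}·σ_{i_L}⋯σ_{i_1}σ_{i_0} of Z^{I_0} cannot be written as a product of fewer than L+L'+2 elements of {σ_i : i ∈ I_0}; that is, the concatenated word s_{j_{L'}}⋯s_{j_0}s_{i_L}⋯s_{i_0} is a reduced expression in the Weyl group of g_0. -/
open AffCase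

/-! ### Word length and inverted vectors -/

theorem pairing_sub_mul_stdb (c : AffCase) {i : ℕ} (hi : i ∈ I0 c) (v : ℕ → ℤ) (a : ℤ) :
    pairing c i (fun j => v j - if j = i then a else 0) = pairing c i v - 2 * a := by
  simp [pairing, mul_sub, Finset.sum_sub_distrib, hi, cartan]

theorem sref_sref (c : AffCase) {i : ℕ} (hi : i ∈ I0 c) (v : ℕ → ℤ) :
    sref c i (sref c i v) = v := by
  have h : pairing c i (sref c i v) = -pairing c i v := by
    have := pairing_sub_mul_stdb c hi v (pairing c i v)
    unfold sref
    linarith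
  funext j
  rw [sref, h, sref]
  split_ifs <;> ring

theorem wordApply_injective (c : AffCase) (w : List ℕ) (hw : ∀ i ∈ w, i ∈ I0 c) :
    Function.Injective (wordApply c w) := by
  induction w with
  | nil => exact fun _ _ h => h
  | cons i w ih =>
    rw [List.forall_mem_cons] at hw
    exact (Function.LeftInverse.injective (sref_sref c hw.1)).comp (ih hw.2)

/-- If every `σ_i` maps `S` into itself apart from `e_i`, then a word in the simple reflections is
at least as long as the number of elements of `S` it moves out of `S`. -/
theorem card_le_length_of_wordApply_notMem (c : AffCase) {S : Set (ℕ → ℤ)}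
    (hS : ∀ v ∈ S, ∀ i ∈ I0 c, v = stdb i ∨ sref c i v ∈ S) (w : List ℕ)
    (hw : ∀ i ∈ w, i ∈ I0 c) (G : Finset (ℕ → ℤ)) (hG : ∀ v ∈ G, v ∈ S)
    (hout : ∀ v ∈ G, wordApply c w v ∉ S) : G.card ≤ w.length := by
  classical
  induction w generalizing G with
  | nil =>
    have : G = ∅ := Finset.eq_empty_of_forall_notMem fun v hv => hout v hv (hG v hv)
    simp [this]
  | cons i w ih =>
    rw [List.forall_mem_cons] at hw
    have hsimple : ∀ v ∈ G.filter (fun v => ¬ wordApply c w v ∉ S), wordApply c w v = stdb i := by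
      intro v hv
      rw [Finset.mem_filter, not_not] at hv
      exact (hS _ hv.2 i hw.1).resolve_right (hout v hv.1)
    have hone : (G.filter fun v => ¬ wordApply c w v ∉ S).card ≤ 1 :=
      Finset.card_le_one.2 fun u hu v hv =>
        wordApply_injective c w hw.2 ((hsimple u hu).trans (hsimple v hv).symm)
    have hrest := ih hw.2 (G.filter fun v => wordApply c w v ∉ S)
      (fun v hv => hG v (Finset.mem_filter.1 hv).1) (fun v hv => (Finset.mem_filter.1 hv).2)
    have hsum := Finset.card_filter_add_card_filter_not (s := G) fun v => wordApply c w v ∉ S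
    rw [List.length_cons]
    omega

/-! ### Vectors as lists of coefficients -/

/-- The vector whose coefficients are the entries of a list, starting with the unused index `0`. -/
def vec (l : List ℤ) : ℕ → ℤ := fun j => l.getD j 0

/-- The indices `j` with `c_{ij} ≠ 0`. -/
def cartanSupport (c : AffCase) (i : ℕ) : List ℕ :=
  (List.range' 1 (rank c)).filter fun j => cartan c i j ≠ 0

/-- The pairing `⟨h_i, v⟩` for a vector given by its list of coefficients. -/
def listPairing (c : AffCase) (i : ℕ) (l : List ℤ) : ℤ :=
  ((cartanSupport c i).map fun j => cartan c i j * vec l j).sum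

/-- The simple reflection `σ_i` on lists of coefficients. -/
def listRefl (c : AffCase) (i : ℕ) (l : List ℤ) : List ℤ :=
  l.set i (vec l i - listPairing c i l)

/-- The analogue of `srefs` on lists of coefficients. -/
def listRefls (c : AffCase) (f : ℕ → ℕ) : ℕ → List ℤ → List ℤ
  | 0, l => l
  | k + 1, l => listRefl c (f (k + 1)) (listRefls c f k l)

/-- The simple root `e_i` as a list of coefficients. -/
def simpleRoot (c : AffCase) (i : ℕ) : List ℤ :=
  (List.replicate (rank c + 1) 0).set i 1

theorem mem_range'_rank {c : AffCase} {i : ℕ} : i ∈ List.range' 1 (rank c) ↔ i ∈ I0 c := by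
  rw [List.mem_range'_1, I0, Finset.mem_Icc]
  omega

theorem listPairing_eq (c : AffCase) (i : ℕ) (l : List ℤ) :
    listPairing c i l = pairing c i (vec l) := by
  have hI : (cartanSupport c i).toFinset = (I0 c).filter fun j => cartan c i j ≠ 0 := by
    ext j
    simp [cartanSupport, ← mem_range'_rank]
  have hnodup : (cartanSupport c i).Nodup := List.Nodup.filter _ List.nodup_range'
  rw [listPairing, ← List.sum_toFinset _ hnodup, hI, pairing,
    Finset.sum_filter_of_ne]
  exact fun j _ h => left_ne_zero_of_mul h

theorem vec_injective {l m : List ℤ} (hlen : l.length = m.length) (h : vec l = vec m) : l = m := by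
  refine List.ext_getElem hlen fun j hl hm => ?_
  simpa [vec, hl, hm] using congrFun h j

theorem vec_set {l : List ℤ} {i : ℕ} (hi : i < l.length) (x : ℤ) (j : ℕ) :
    vec (l.set i x) j = if j = i then x else vec l j := by
  by_cases h : j = i
  · subst h
    simp [vec, hi]
  · simp [vec, h, Ne.symm h]

@[simp]
theorem length_listRefl (c : AffCase) (i : ℕ) (l : List ℤ) :
    (listRefl c i l).length = l.length := by
  simp [listRefl]

@[simp]
theorem length_listRefls (c : AffCase) (f : ℕ → ℕ) (k : ℕ) (l : List ℤ) :
    (listRefls c f k l).length = l.length := by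
  induction k with
  | zero => rfl
  | succ k ih => rw [listRefls, length_listRefl, ih]

@[simp]
theorem length_simpleRoot (c : AffCase) (i : ℕ) : (simpleRoot c i).length = rank c + 1 := by
  simp [simpleRoot]

theorem vec_simpleRoot {c : AffCase} {i : ℕ} (hi : i ∈ I0 c) : vec (simpleRoot c i) = stdb i := by
  rw [I0, Finset.mem_Icc] at hi
  funext j
  rw [simpleRoot, vec_set (by simp; omega), stdb]
  refine if_congr Iff.rfl rfl ?_
  simp only [vec, List.getD_eq_getElem?_getD, List.getElem?_replicate]
  split_ifs <;> rfl

theorem vec_listRefl {c : AffCase} {i : ℕ} (hi : i ∈ I0 c) {l : List ℤ}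
    (hl : l.length = rank c + 1) : vec (listRefl c i l) = sref c i (vec l) := by
  rw [I0, Finset.mem_Icc] at hi
  funext j
  rw [listRefl, vec_set (by omega), listPairing_eq, sref]
  split_ifs with h
  · rw [h]
  · rw [sub_zero]

theorem vec_listRefls {c : AffCase} {f : ℕ → ℕ} {k : ℕ} (hf : ∀ j ≤ k, f j ∈ I0 c) {l : List ℤ}
    (hl : l.length = rank c + 1) : vec (listRefls c f k l) = srefs c f k (vec l) := by
  induction k with
  | zero => rfl
  | succ k ih =>
    rw [listRefls, srefs, vec_listRefl (hf _ le_rfl) (by simpa using hl),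
      ih fun j hj => hf j (hj.trans k.le_succ)]

/-! ### Exhaustive search over all sequences -/

/-- A root together with the images of a list of test vectors. -/
abbrev SearchState := List ℤ × List (List ℤ)

/-- The states reached from those in `S` by one admissible reflection with index in `A`. -/
def nextStates (c : AffCase) (A : List ℕ) (S : List SearchState) : List SearchState :=
  (S.flatMap fun s => (A.filter fun i => listPairing c i s.1 = -cconst c).map
    fun i => (listRefl c i s.1, s.2.map (listRefl c i))).dedup

/-- Whether `P` holds at every state with root `t` that is reachable from `S` by admissible
reflections; the first number bounds the number of steps, the second one is the current step. -/
def search (c : AffCase) (A : List ℕ) (t : List ℤ) (P : ℕ → List (List ℤ) → Bool) :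
    ℕ → ℕ → List SearchState → Bool
  | 0, _, _ => false
  | n + 1, k, S => S.isEmpty ||
      (S.all (fun s => s.1 != t || P k s.2) && search c A t P n (k + 1) (nextStates c A S))

theorem search_sound {c : AffCase} {A : List ℕ} {t : List ℤ} {P : ℕ → List (List ℤ) → Bool}
    {f : ℕ → ℕ} {L : ℕ} {r : List ℤ} {G : List (List ℤ)} (hA : ∀ j ≤ L, f j ∈ A)
    (hstep : ∀ j < L, listPairing c (f (j + 1)) (listRefls c f j r) = -cconst c)
    (ht : listRefls c f L r = t) (n k : ℕ) (S : List SearchState) (hk : k ≤ L)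
    (hmem : (listRefls c f k r, G.map (listRefls c f k)) ∈ S)
    (h : search c A t P n k S = true) : P L (G.map (listRefls c f L)) = true := by
  induction n generalizing k S with
  | zero => simp [search] at h
  | succ n ih =>
    rw [search, Bool.or_eq_true, Bool.and_eq_true] at h
    obtain ⟨hall, hnext⟩ := h.resolve_left fun he => by simp_all
    rcases hk.eq_or_lt with rfl | hlt
    · simpa [ht] using List.all_eq_true.1 hall _ hmem
    · refine ih (k + 1) _ hlt ?_ hnext
      rw [nextStates, List.mem_dedup, List.mem_flatMap]
      refine ⟨_, hmem, List.mem_map.2 ⟨f (k + 1), ?_, ?_⟩⟩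
      · rw [List.mem_filter]
        exact ⟨hA _ hlt, decide_eq_true (hstep k hlt)⟩
      · rw [List.map_map]
        rfl

/-! ### The root data -/

/-- The union of the first `n` levels above `S`, a level being obtained from the preceding one by
the reflections that increase a root. -/
def rootLevels (c : AffCase) : ℕ → List (List ℤ) → List (List ℤ)
  | 0, _ => []
  | n + 1, S => S ++ rootLevels c n
      (S.flatMap fun v => ((List.range' 1 (rank c)).filter
        fun i => listPairing c i v < 0).map fun i => listRefl c i v).dedup

/-- The positive roots; the longest case has `29` levels. -/
def posRoots (c : AffCase) : List (List ℤ) :=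
  rootLevels c 29 ((List.range' 1 (rank c)).map (simpleRoot c))

/-- The coefficients of `θ_1`. -/
def theta1List : AffCase → List ℤ
  | E6 => [0, 0, 1, 1, 1, 1, 1]
  | E7 => [0, 0, 1, 2, 1, 2, 2, 1]
  | E8 => [0, 0, 1, 2, 3, 4, 2, 3, 2]
  | F4 => [0, 0, 1, 2, 2]
  | E62 => [0, 0, 1, 1, 1]

/-- The coefficients of `θ_J`. -/
def thetaJList : AffCase → List ℤ
  | E6 => [0, 0, 1, 1, 1, 0, 0]
  | E7 => [0, 0, 1, 2, 1, 1, 0, 0]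
  | E8 => [0, 0, 1, 2, 2, 2, 1, 1, 0]
  | F4 => [0, 0, 1, 2, 0]
  | E62 => [0, 0, 1, 1, 0]

/-- The elements of `J`. -/
def JList : AffCase → List ℕ
  | E6 => [2, 3, 4]
  | E7 => [2, 3, 4, 5]
  | E8 => [2, 3, 4, 5, 6, 7]
  | F4 => [2, 3]
  | E62 => [2, 3]

/-- An i-sequence followed by a j-sequence. -/
def sampleWord : AffCase → List ℕ
  | E6 => [2, 3, 4, 5, 6, 2, 3, 4]
  | E7 => [2, 3, 4, 5, 3, 6, 5, 7, 6, 2, 3, 4, 5, 3]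
  | E8 => [2, 3, 4, 5, 6, 7, 5, 4, 3, 8, 7, 5, 4, 6, 5, 7, 8, 2, 3, 4, 5, 6, 7, 5, 4, 3]
  | F4 => [2, 3, 4, 2, 3]
  | E62 => [2, 3, 4, 2, 3]

/-- The roots inverted by a reduced word whose head is applied first. -/
def invertedRoots (c : AffCase) : List ℕ → List (List ℤ)
  | [] => []
  | i :: w => simpleRoot c i :: (invertedRoots c w).map (listRefl c i)

/-- The state after the initial reflection `σ_2`. -/
def initialState (c : AffCase) (G : List (List ℤ)) : SearchState :=
  (simpleRoot c 2, G.map (listRefl c 2))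

theorem vec_theta1List (c : AffCase) : vec (theta1List c) = theta1 c := by
  cases c <;> rfl

theorem vec_thetaJList (c : AffCase) : vec (thetaJList c) = thetaJ c := by
  cases c <;> rfl

theorem length_theta1List (c : AffCase) : (theta1List c).length = rank c + 1 := by
  cases c <;> rfl

theorem length_thetaJList (c : AffCase) : (thetaJList c).length = rank c + 1 := by
  cases c <;> rfl

theorem mem_JList {c : AffCase} {i : ℕ} : i ∈ JList c ↔ i ∈ Jset c := by
  cases c <;> simp [JList, Jset]

theorem mem_range'_two {c : AffCase} {i : ℕ} : i ∈ List.range' 2 (rank c - 1) ↔ i ∈ I01 c := by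
  have : 1 ≤ rank c := by cases c <;> decide
  rw [List.mem_range'_1, I01, Finset.mem_Icc]
  omega

theorem length_of_mem_posRoots (c : AffCase) : ∀ v ∈ posRoots c, v.length = rank c + 1 := by
  cases c <;> decide +kernel

theorem posRoots_closed (c : AffCase) : ∀ v ∈ posRoots c, ∀ i ∈ List.range' 1 (rank c),
    listPairing c i v = 0 ∨ v = simpleRoot c i ∨ listRefl c i v ∈ posRoots c := by
  cases c <;> decide +kernel

theorem nodup_invertedRoots (c : AffCase) : (invertedRoots c (sampleWord c)).Nodup := by
  cases c <;> decide +kernel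

theorem invertedRoots_subset (c : AffCase) :
    ∀ v ∈ invertedRoots c (sampleWord c), v ∈ posRoots c := by
  cases c <;> decide +kernel

/-- Every i-sequence followed by every j-sequence inverts the roots in
`invertedRoots c (sampleWord c)`, and these are at least as many as the reflections used. -/
theorem search_invertedRoots (c : AffCase) :
    search c (List.range' 2 (rank c - 1)) (theta1List c) (fun L G =>
      search c (JList c) (thetaJList c)
        (fun L' G' => L + L' + 2 ≤ G'.length ∧ ∀ v ∈ G', v ∉ posRoots c)
        20 0 [initialState c G])
      20 0 [initialState c (invertedRoots c (sampleWord c))] = true := by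
  cases c <;> decide +kernel

/-- `search_sound` for a sequence in terms of `srefs`, starting at the root `e_2`. -/
theorem search_sound_of_srefs {c : AffCase} {A : List ℕ} {t : List ℤ}
    {P : ℕ → List (List ℤ) → Bool} {f : ℕ → ℕ} {L n : ℕ} {G : List (List ℤ)}
    (hA : ∀ k ≤ L, f k ∈ A) (hI : ∀ k ≤ L, f k ∈ I0 c) (hf0 : f 0 = 2)
    (hstep : ∀ k, 1 ≤ k → k ≤ L →
      pairing c (f k) (srefs c f (k - 1) (stdb 2)) = -(cconst c))
    (htlen : t.length = rank c + 1) (ht : srefs c f L (stdb 2) = vec t)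
    (h : search c A t P n 0 [initialState c G] = true) :
    P L (G.map fun v => listRefls c f L (listRefl c (f 0) v)) = true := by
  have hvec : ∀ k ≤ L, vec (listRefls c f k (simpleRoot c 2)) = srefs c f k (stdb 2) := by
    intro k hk
    rw [vec_listRefls (fun j hj => hI j (hj.trans hk)) (length_simpleRoot c 2),
      vec_simpleRoot (two_mem_I0 c)]
  have := search_sound (f := f) (L := L) (r := simpleRoot c 2) (G := G.map (listRefl c 2)) hA
    (fun j hj => by
      rw [listPairing_eq, hvec j hj.le]
      exact hstep (j + 1) (Nat.le_add_left 1 j) hj)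
    (vec_injective (by simp [htlen]) ((hvec L le_rfl).trans ht)) n 0 _ L.zero_le
    (by simp [initialState, listRefls]) h
  rw [List.map_map] at this
  rwa [hf0]

/-- The vectors of the positive roots. -/
def posRootSet (c : AffCase) : Set (ℕ → ℤ) := {u | ∃ v ∈ posRoots c, vec v = u}

theorem posRootSet_closed (c : AffCase) :
    ∀ u ∈ posRootSet c, ∀ i ∈ I0 c, u = stdb i ∨ sref c i u ∈ posRootSet c := by
  rintro _ ⟨v, hv, rfl⟩ i hi
  rcases posRoots_closed c v hv i (mem_range'_rank.2 hi) with h | rfl | h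
  · refine Or.inr ⟨v, hv, ?_⟩
    funext j
    simp [sref, ← listPairing_eq, h]
  · exact Or.inl (vec_simpleRoot hi)
  · exact Or.inr ⟨_, h, vec_listRefl hi (length_of_mem_posRoots c v hv)⟩

theorem vec_notMem_posRootSet {c : AffCase} {v : List ℤ} (hlen : v.length = rank c + 1)
    (hv : v ∉ posRoots c) : vec v ∉ posRootSet c := by
  rintro ⟨u, hu, huv⟩
  exact hv (vec_injective ((length_of_mem_posRoots c u hu).trans hlen.symm) huv ▸ hu)

theorem stmt7 (c : AffCase) (L L' : ℕ) (f g : ℕ → ℕ)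
    (hf : IsISeq c L f) (hg : IsJSeq c L' g) :
    ¬ ∃ w : List ℕ, (∀ i ∈ w, i ∈ I0 c) ∧ w.length < L + L' + 2 ∧
      ∀ v : ℕ → ℤ, wordApply c w v =
        srefs c g L' (sref c (g 0) (srefs c f L (sref c (f 0) v))) := by
  classical
  rintro ⟨w, hw, hlen, heq⟩
  obtain ⟨hfA, hf0, hfstep, hft⟩ := hf
  obtain ⟨hgA, hg0, hgstep, hgt⟩ := hg
  have hfI : ∀ k ≤ L, f k ∈ I0 c := fun k hk => I01_subset_I0 c (hfA k hk)
  have hgI : ∀ k ≤ L', g k ∈ I0 c := fun k hk => Jset_subset_I0 c (hgA k hk)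
  have hi := search_sound_of_srefs (fun k hk => mem_range'_two.2 (hfA k hk)) hfI hf0 hfstep
    (length_theta1List c) (hft.trans (vec_theta1List c).symm) (search_invertedRoots c)
  have hj := search_sound_of_srefs (fun k hk => mem_JList.2 (hgA k hk)) hgI hg0 hgstep
    (length_thetaJList c) (hgt.trans (vec_thetaJList c).symm) hi
  obtain ⟨hcount, hout⟩ := of_decide_eq_true hj
  simp only [List.map_map, List.length_map, List.forall_mem_map, Function.comp_apply] at hcount hout
  set R := invertedRoots c (sampleWord c)
  have hRlen : ∀ v ∈ R, v.length = rank c + 1 := fun v hv =>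
    length_of_mem_posRoots c v (invertedRoots_subset c v hv)
  have hcard : (R.toFinset.image vec).card = R.length := by
    rw [Finset.card_image_of_injOn, List.toFinset_card_of_nodup (nodup_invertedRoots c)]
    intro u hu v hv huv
    rw [Finset.mem_coe, List.mem_toFinset] at hu hv
    exact vec_injective ((hRlen u hu).trans (hRlen v hv).symm) huv
  have hle := card_le_length_of_wordApply_notMem c (posRootSet_closed c) w hw
    (R.toFinset.image vec)
    (by
      simp only [Finset.mem_image, List.mem_toFinset]
      rintro _ ⟨v, hv, rfl⟩
      exact ⟨v, invertedRoots_subset c v hv, rfl⟩)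
    (by
      simp only [Finset.mem_image, List.mem_toFinset]
      rintro _ ⟨v, hv, rfl⟩
      have hl := hRlen v hv
      rw [heq, ← vec_listRefl (hfI 0 L.zero_le) hl, ← vec_listRefls hfI (by simpa using hl),
        ← vec_listRefl (hgI 0 L'.zero_le) (by simpa using hl),
        ← vec_listRefls hgI (by simpa using hl)]
      exact vec_notMem_posRootSet (by simpa using hl) (hout v hv))
  omega
end
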